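/- arXiv:1601.03911 — 2 statements merged into one kernel-verified Lean document; each statement's English description precedes it below -/
import Mathlib

section
/- Assume either 1 < α ≤ 2 with 1/β₁ + 1/β₂ > α and 1/α < βᵢ < 1/(α−1) for i = 1,2, or 0 < α ≤ 1 with βᵢ > 1/α for i = 1,2 and 1/β₁ + 1/β₂ > α. Then the doubly-indexed limit, as n → ∞ and m → ∞ (along the product filter), of ρ(n,−m)/(n^{1−β₁α} m^{1−β₂α}) exists and equals the (finite) integral ∫₀^∞ ∫₀^∞ V((1+u)^{−β₁} v^{−β₂}, u^{−β₁} (1+v)^{−β₂}) du dv. -/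
open Filter MeasureTheory Real Set

/-- The kernel `V(x,y) = xy/(x^2+y^2)^{(2-α)/2}` with `V(0,0)=0`. -/
noncomputable def V (α : ℝ) : ℝ → ℝ → ℝ := fun x y =>
  if x = 0 ∧ y = 0 then 0 else x * y / (x ^ 2 + y ^ 2) ^ ((2 - α) / 2)

theorem V_bound (α θ X Y : ℝ) (hX : X ≠ 0) (hY : Y ≠ 0) (h1 : θ ≤ 1) (h2 : α - 1 ≤ θ) :
    |V α X Y| ≤ |X| ^ θ * |Y| ^ (α - θ) := by
  have hX' : 0 < |X| := abs_pos.2 hX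
  have hY' : 0 < |Y| := abs_pos.2 hY
  have hS : 0 < X ^ 2 + Y ^ 2 := by positivity
  have hR : 0 < √(X ^ 2 + Y ^ 2) := Real.sqrt_pos.2 hS
  have e : (X ^ 2 + Y ^ 2) ^ ((2 - α) / 2) = √(X ^ 2 + Y ^ 2) ^ (1 - θ) * √(X ^ 2 + Y ^ 2) ^ (1 - α + θ) := by
    rw [← Real.rpow_add hR, Real.sqrt_eq_rpow, ← Real.rpow_mul hS.le]
    congr 1; ring
  have hXR : |X| ≤ √(X ^ 2 + Y ^ 2) := Real.abs_le_sqrt (by nlinarith [sq_nonneg Y])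
  have hYR : |Y| ≤ √(X ^ 2 + Y ^ 2) := Real.abs_le_sqrt (by nlinarith [sq_nonneg X])
  have i1 : |X| ^ (1 - θ) ≤ √(X ^ 2 + Y ^ 2) ^ (1 - θ) :=
    Real.rpow_le_rpow hX'.le hXR (by linarith)
  have i2 : |Y| ^ (1 - α + θ) ≤ √(X ^ 2 + Y ^ 2) ^ (1 - α + θ) :=
    Real.rpow_le_rpow hY'.le hYR (by linarith)
  have hpos : 0 < (X ^ 2 + Y ^ 2) ^ ((2 - α) / 2) := Real.rpow_pos_of_pos hS _
  have hV : |V α X Y| = |X| * |Y| / (X ^ 2 + Y ^ 2) ^ ((2 - α) / 2) := by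
    simp only [V]
    rw [if_neg (fun h => hX h.1), abs_div, abs_mul, abs_of_pos hpos]
  rw [hV, div_le_iff₀ hpos, e]
  calc |X| * |Y| = (|X| ^ θ * |X| ^ (1 - θ)) * (|Y| ^ (α - θ) * |Y| ^ (1 - α + θ)) := by
        rw [← Real.rpow_add hX', ← Real.rpow_add hY']
        rw [show θ + (1 - θ) = 1 by ring, show α - θ + (1 - α + θ) = 1 by ring,
          Real.rpow_one, Real.rpow_one]
    _ = (|X| ^ θ * |Y| ^ (α - θ)) * (|X| ^ (1 - θ) * |Y| ^ (1 - α + θ)) := by ring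
    _ ≤ _ := by gcongr

theorem V_scale (α k X Y : ℝ) (hk : 0 < k) (hX : X ≠ 0) :
    V α (k * X) (k * Y) = k ^ α * V α X Y := by
  have hS : 0 < X ^ 2 + Y ^ 2 := by positivity
  simp only [V]
  rw [if_neg (fun h => (mul_ne_zero hk.ne' hX) h.1), if_neg (fun h => hX h.1)]
  have : (k * X) ^ 2 + (k * Y) ^ 2 = k ^ 2 * (X ^ 2 + Y ^ 2) := by ring
  rw [this, Real.mul_rpow (by positivity) hS.le]
  have e : (k ^ 2) ^ ((2 - α) / 2) = k ^ (2:ℝ) / k ^ α := by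
    rw [← Real.rpow_sub hk, ← Real.rpow_natCast, ← Real.rpow_mul hk.le]
    congr 1; push_cast; ring
  rw [e, Real.rpow_two]
  have := Real.rpow_pos_of_pos hk α
  have := Real.rpow_pos_of_pos hS ((2 - α) / 2)
  field_simp

theorem V_tendsto {ι : Type*} {l : Filter ι} (α X Y : ℝ) (hX : X ≠ 0) {f g : ι → ℝ}
    (hf : Tendsto f l (nhds X)) (hg : Tendsto g l (nhds Y)) :
    Tendsto (fun i => V α (f i) (g i)) l (nhds (V α X Y)) := by
  have hS : 0 < X ^ 2 + Y ^ 2 := by positivity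
  have h : Tendsto (fun i => f i * g i / (f i ^ 2 + g i ^ 2) ^ ((2 - α) / 2)) l
      (nhds (X * Y / (X ^ 2 + Y ^ 2) ^ ((2 - α) / 2))) := by
    refine (hf.mul hg).div ?_ (Real.rpow_pos_of_pos hS _).ne'
    exact ((hf.pow 2).add (hg.pow 2)).rpow_const (Or.inl hS.ne')
  have e : V α X Y = X * Y / (X ^ 2 + Y ^ 2) ^ ((2 - α) / 2) := by
    simp only [V]; rw [if_neg (fun h => hX h.1)]
  rw [e]
  refine h.congr' ?_
  filter_upwards [hf.eventually_ne hX] with i hi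
  simp only [V]; rw [if_neg (fun h => hi h.1)]

theorem V_meas (α : ℝ) : Measurable (fun p : ℝ × ℝ => V α p.1 p.2) := by
  unfold V
  refine Measurable.ite ?_ (by fun_prop) (by fun_prop)
  exact (measurableSet_eq_fun measurable_fst measurable_const).inter
    (measurableSet_eq_fun measurable_snd measurable_const)

theorem g_int (p q : ℝ) (hp : 0 ≤ p) (hq : q < 1) (hpq : 1 < p + q) :
    IntegrableOn (fun u : ℝ => (1 + u) ^ (-p) * u ^ (-q)) (Ioi 0) := by
  rw [← Ioc_union_Ioi_eq_Ioi (zero_le_one (α := ℝ))]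
  have hm : Measurable (fun u : ℝ => (1 + u) ^ (-p) * u ^ (-q)) := by fun_prop
  refine IntegrableOn.union ?_ ?_
  · have h : IntegrableOn (fun u : ℝ => u ^ (-q)) (Ioc 0 1) := by
      rw [← intervalIntegrable_iff_integrableOn_Ioc_of_le zero_le_one]
      exact intervalIntegral.intervalIntegrable_rpow' (by linarith)
    refine Integrable.mono' h hm.aestronglyMeasurable ?_
    filter_upwards [ae_restrict_mem measurableSet_Ioc] with u hu
    have h0 := Real.rpow_nonneg hu.1.le (-q)
    have h1 : (1 + u) ^ (-p) ≤ 1 := Real.rpow_le_one_of_one_le_of_nonpos (by linarith [hu.1]) (by linarith)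
    have h2 : 0 ≤ (1 + u) ^ (-p) := Real.rpow_nonneg (by linarith [hu.1]) _
    rw [Real.norm_of_nonneg (by positivity)]
    nlinarith
  · have h : IntegrableOn (fun u : ℝ => u ^ (-(p+q))) (Ioi 1) :=
      integrableOn_Ioi_rpow_of_lt (by linarith) one_pos
    refine Integrable.mono' h hm.aestronglyMeasurable ?_
    filter_upwards [ae_restrict_mem measurableSet_Ioi] with u hu
    have hu0 : 0 < u := lt_trans one_pos hu
    have h0 := Real.rpow_nonneg hu0.le (-q)
    have h1 : (1 + u) ^ (-p) ≤ u ^ (-p) :=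
      Real.rpow_le_rpow_of_nonpos hu0 (by linarith) (by linarith)
    have h2 : 0 ≤ (1 + u) ^ (-p) := Real.rpow_nonneg (by linarith) _
    rw [Real.norm_of_nonneg (by positivity), neg_add, Real.rpow_add hu0]
    gcongr

theorem map_floor (n : ℕ) (hn : 1 ≤ n) :
    Measure.map (fun s : ℝ => ⌊(n:ℝ) * s⌋₊) (volume.restrict (Ioi 0)) =
      ENNReal.ofReal (1 / n) • Measure.count := by
  have hn0 : (0:ℝ) < n := by exact_mod_cast hn
  have hm : Measurable (fun s : ℝ => ⌊(n:ℝ) * s⌋₊) :=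
    Nat.measurable_floor.comp (by fun_prop)
  refine Measure.ext_of_singleton fun i => ?_
  rw [Measure.map_apply hm (measurableSet_singleton i), restrict_Ioi_eq_restrict_Ici,
    Measure.restrict_apply (hm (measurableSet_singleton i))]
  have : (fun s : ℝ => ⌊(n:ℝ) * s⌋₊) ⁻¹' {i} ∩ Ici 0 = Ico ((i:ℝ) / n) ((i + 1) / n) := by
    ext s
    simp only [mem_inter_iff, mem_preimage, mem_singleton_iff, mem_Ici, mem_Ico]
    rw [div_le_iff₀ hn0, lt_div_iff₀ hn0, mul_comm s]
    constructor
    · rintro ⟨h, hs⟩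
      exact (Nat.floor_eq_iff (by positivity)).1 h
    · intro h
      have h3 : 0 ≤ (n:ℝ) * s := le_trans (Nat.cast_nonneg i) h.1
      exact ⟨(Nat.floor_eq_iff h3).2 h, (mul_nonneg_iff_of_pos_left hn0).1 h3⟩
  rw [this, Real.volume_Ico]
  simp only [Measure.smul_apply, Measure.count_singleton, smul_eq_mul, mul_one]
  congr 1; ring

theorem int_floor (n : ℕ) (hn : 1 ≤ n) (h : ℕ → ℝ) (hs : Summable h) :
    ∫ s in Ioi (0:ℝ), h ⌊(n:ℝ) * s⌋₊ = (1 / n) * ∑' i, h i := by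
  have hm : Measurable (fun s : ℝ => ⌊(n:ℝ) * s⌋₊) :=
    Nat.measurable_floor.comp (by fun_prop)
  rw [← integral_map (φ := fun s : ℝ => ⌊(n:ℝ) * s⌋₊) (f := h) hm.aemeasurable
    (measurable_from_top.aestronglyMeasurable), map_floor n hn, integral_smul_measure,
    ENNReal.toReal_ofReal (by positivity), smul_eq_mul]
  congr 1
  rw [integral_countable']
  · simp [Measure.real]
  · rw [integrable_count_iff]; exact hs.norm

theorem w_bdd (w : ℕ → ℕ → ℝ) 
    (hA1 : Tendsto (fun p : ℕ × ℕ => w p.1 p.2) (atTop ×ˢ atTop) (nhds 1))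
    (winf : ℕ → ℝ)
    (hA2 : ∀ i, Tendsto (fun j => w i j) atTop (nhds (winf i)))
    (wco : ℕ → ℝ)
    (hA3 : ∀ j, Tendsto (fun i => w i j) atTop (nhds (wco j))) :
    ∃ b, 0 < b ∧ ∀ i j, |w i j| ≤ b := by
  have hB : ∀ i, ∃ B, 0 ≤ B ∧ ∀ j, |w i j| ≤ B := fun i => by
    obtain ⟨B, hB⟩ := (Metric.isBounded_range_of_tendsto _ (hA2 i)).exists_norm_le
    exact ⟨B, (norm_nonneg _).trans (hB _ ⟨0, rfl⟩), fun j => hB _ ⟨j, rfl⟩⟩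
  have hB' : ∀ j, ∃ B, 0 ≤ B ∧ ∀ i, |w i j| ≤ B := fun i => by
    obtain ⟨B, hB⟩ := (Metric.isBounded_range_of_tendsto _ (hA3 i)).exists_norm_le
    exact ⟨B, (norm_nonneg _).trans (hB _ ⟨0, rfl⟩), fun j => hB _ ⟨j, rfl⟩⟩
  choose B hB0 hB using hB
  choose B' hB0' hB' using hB'
  have h2 : ∀ᶠ p : ℕ × ℕ in atTop ×ˢ atTop, |w p.1 p.2| < 2 :=
    (hA1.abs).eventually_lt_const (by norm_num)
  rw [prod_atTop_atTop_eq, eventually_atTop] at h2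
  obtain ⟨⟨N, M⟩, hN⟩ := h2
  have s1 := Finset.sum_nonneg (s := Finset.range N) (fun i _ => hB0 i)
  have s2 := Finset.sum_nonneg (s := Finset.range M) (fun i _ => hB0' i)
  refine ⟨2 + ∑ i ∈ Finset.range N, B i + ∑ i ∈ Finset.range M, B' i, by positivity, fun i j => ?_⟩
  rcases lt_or_ge i N with hi | hi
  · have := Finset.single_le_sum (f := B) (fun i _ => hB0 i) (Finset.mem_range.2 hi)
    linarith [hB i j]
  · rcases lt_or_ge j M with hj | hj
    · have := Finset.single_le_sum (f := B') (fun i _ => hB0' i) (Finset.mem_range.2 hj)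
      linarith [hB' j i]
    · have := hN (i, j) ⟨hi, hj⟩
      simp only at this
      linarith

theorem exists_theta (α β₁ β₂ : ℝ)
    (hcond : (1 < α ∧ α ≤ 2 ∧ 1 / β₁ + 1 / β₂ > α ∧ 1 / α < β₁ ∧
        β₁ < 1 / (α - 1) ∧ 1 / α < β₂ ∧ β₂ < 1 / (α - 1)) ∨
      (0 < α ∧ α ≤ 1 ∧ 1 / α < β₁ ∧ 1 / α < β₂ ∧ 1 / β₁ + 1 / β₂ > α)) :
    ∃ θ, 0 < β₁ ∧ 0 < β₂ ∧ 1 < β₁ * α ∧ 1 < β₂ * α ∧ 0 ≤ θ ∧ α - 1 ≤ θ ∧ θ ≤ 1 ∧ θ ≤ α ∧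
      β₁ * (α - θ) < 1 ∧ β₂ * θ < 1 := by
  have hα : 0 < α := by rcases hcond with h | h <;> linarith [h.1]
  have hα2 : α ≤ 2 := by rcases hcond with h | h <;> linarith [h.2.1]
  have h1 : 1 / α < β₁ := by rcases hcond with h | h <;> tauto
  have h2 : 1 / α < β₂ := by rcases hcond with h | h <;> tauto
  have h3 : α < 1 / β₁ + 1 / β₂ := by rcases hcond with h | h <;> tauto
  have b1 : 0 < β₁ := lt_trans (by positivity) h1
  have b2 : 0 < β₂ := lt_trans (by positivity) h2
  have k1 : α - 1 < 1 / β₁ := by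
    rcases hcond with h | h
    · have := h.2.2.2.2.1
      rw [lt_div_iff₀ (by linarith [h.1])] at this
      rw [lt_div_iff₀ b1]; linarith
    · have : 0 < 1 / β₁ := by positivity
      linarith [h.2.1]
  have k2 : α - 1 < 1 / β₂ := by
    rcases hcond with h | h
    · have := h.2.2.2.2.2.2
      rw [lt_div_iff₀ (by linarith [h.1])] at this
      rw [lt_div_iff₀ b2]; linarith
    · have : 0 < 1 / β₂ := by positivity
      linarith [h.2.1]
  have p1 : 0 < 1 / β₁ := by positivity
  have p2 : 0 < 1 / β₂ := by positivity
  have key : ∃ θ, 0 ≤ θ ∧ α - 1 ≤ θ ∧ θ ≤ 1 ∧ θ ≤ α ∧ α - θ < 1 / β₁ ∧ θ < 1 / β₂ := by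
    rcases hα2.eq_or_lt with h | h
    · subst h
      exact ⟨1, by norm_num, by norm_num, le_rfl, by norm_num, by linarith, by linarith⟩
    · have : max (α - 1 / β₁) (max 0 (α - 1)) < min (1 / β₂) (min 1 α) := by
        simp only [max_lt_iff, lt_min_iff]
        refine ⟨⟨?_, ?_, ?_⟩, ⟨?_, ?_, ?_⟩, ?_, ?_, ?_⟩ <;> linarith
      obtain ⟨θ, ha, hb⟩ := exists_between this
      simp only [max_lt_iff, lt_min_iff] at ha hb
      refine ⟨θ, ?_, ?_, ?_, ?_, ?_, ?_⟩ <;> linarith [ha.1, ha.2.1, ha.2.2, hb.1, hb.2.1, hb.2.2]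
  obtain ⟨θ, q0, q1, q2, q3, q4, q5⟩ := key
  rw [lt_div_iff₀ b1] at q4
  rw [lt_div_iff₀ b2] at q5
  rw [div_lt_iff₀ hα] at h1 h2
  exact ⟨θ, b1, b2, h1, h2, q0, q1, q2, q3, by linarith, by linarith⟩

/-- product bound -/
theorem prod_bound (α β₁ β₂ θ s t u v : ℝ) (b1 : 0 < β₁) (b2 : 0 < β₂) (h0 : 0 ≤ θ) (hα : θ ≤ α)
    (hs : 0 < s) (ht : 0 < t) (hu : s ≤ u) (hv : t ≤ v) :
    ((1 + u) ^ (-β₁) * v ^ (-β₂)) ^ θ * (u ^ (-β₁) * (1 + v) ^ (-β₂)) ^ (α - θ) ≤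
    ((1 + s) ^ (-(β₁ * θ)) * s ^ (-(β₁ * (α - θ)))) * 
      ((1 + t) ^ (-(β₂ * (α - θ))) * t ^ (-(β₂ * θ))) := by
  have hu0 : 0 < u := hs.trans_le hu
  have hv0 : 0 < v := ht.trans_le hv
  have hx : (1 + u) ^ (-β₁) * v ^ (-β₂) ≤ (1 + s) ^ (-β₁) * t ^ (-β₂) := by
    gcongr ?_ * ?_
    · exact Real.rpow_le_rpow_of_nonpos (by linarith) (by linarith) (by linarith)
    · exact Real.rpow_le_rpow_of_nonpos ht hv (by linarith)
  have hy : u ^ (-β₁) * (1 + v) ^ (-β₂) ≤ s ^ (-β₁) * (1 + t) ^ (-β₂) := by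
    gcongr ?_ * ?_
    · exact Real.rpow_le_rpow_of_nonpos hs hu (by linarith)
    · exact Real.rpow_le_rpow_of_nonpos (by linarith) (by linarith) (by linarith)
  have e1 := Real.rpow_le_rpow (by positivity) hx h0
  have e2 := Real.rpow_le_rpow (by positivity) hy (sub_nonneg.2 hα)
  refine (mul_le_mul e1 e2 (by positivity) (by positivity)).trans (le_of_eq ?_)
  rw [Real.mul_rpow (by positivity) (by positivity), Real.mul_rpow (by positivity) (by positivity),
    ← Real.rpow_mul (by positivity), ← Real.rpow_mul (by positivity), ← Real.rpow_mul (by positivity),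
    ← Real.rpow_mul (by positivity)]
  simp only [neg_mul]
  ring

theorem stmt6 (α β₁ β₂ : ℝ)
    (hcond : (1 < α ∧ α ≤ 2 ∧ 1 / β₁ + 1 / β₂ > α ∧ 1 / α < β₁ ∧
        β₁ < 1 / (α - 1) ∧ 1 / α < β₂ ∧ β₂ < 1 / (α - 1)) ∨
      (0 < α ∧ α ≤ 1 ∧ 1 / α < β₁ ∧ 1 / α < β₂ ∧ 1 / β₁ + 1 / β₂ > α))
    (w : ℕ → ℕ → ℝ) (hw : ∀ i j, w i j ≠ 0)
    (hA1 : Tendsto (fun p : ℕ × ℕ => w p.1 p.2) (atTop ×ˢ atTop) (nhds 1))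
    (winf : ℕ → ℝ)
    (hA2 : ∀ i, Tendsto (fun j => w i j) atTop (nhds (winf i)) ∧ 0 < winf i)
    (wco : ℕ → ℝ)
    (hA3 : ∀ j, Tendsto (fun i => w i j) atTop (nhds (wco j)) ∧ 0 < wco j)
    (c : ℕ → ℕ → ℝ)
    (hc : ∀ i j, c i j = w i j * (1 + (i : ℝ)) ^ (-β₁) * (1 + (j : ℝ)) ^ (-β₂))
    (ρ : ℕ → ℕ → ℝ)
    (hsum : ∀ n m : ℕ, 1 ≤ n → 1 ≤ m →
      Summable (fun q : ℕ × ℕ => V α (c (q.1 + n) q.2) (c q.1 (q.2 + m))))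
    (hρ : ∀ n m : ℕ, 1 ≤ n → 1 ≤ m →
      ρ n m = ∑' i : ℕ, ∑' j : ℕ, V α (c (i + n) j) (c i (j + m)))
    :
    Tendsto (fun p : ℕ × ℕ => ρ p.1 p.2 / ((p.1 : ℝ) ^ (1 - β₁ * α) * (p.2 : ℝ) ^ (1 - β₂ * α)))
      (atTop ×ˢ atTop)
      (nhds (∫ u in Ioi (0 : ℝ), ∫ v in Ioi (0 : ℝ),
        V α ((1 + u) ^ (-β₁) * v ^ (-β₂)) (u ^ (-β₁) * (1 + v) ^ (-β₂)))) := by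
  obtain ⟨θ, b1, b2, hb1, hb2, t0, t1, t2, t3, t4, t5⟩ := exists_theta α β₁ β₂ hcond
  obtain ⟨b, hb0, hb⟩ := w_bdd w hA1 winf (fun i => (hA2 i).1) wco (fun j => (hA3 j).1)
  have hαθ : 0 ≤ α - θ := sub_nonneg.2 t3
  let U : ℕ → ℕ → ℝ := fun n i => (1 + (i:ℝ)) / n
  let H : ℕ → ℕ → ℕ → ℕ → ℝ := fun n m i j =>
    V α (w (i + n) j * ((1 + U n i) ^ (-β₁) * (U m j) ^ (-β₂)))
      (w i (j + m) * ((U n i) ^ (-β₁) * (1 + U m j) ^ (-β₂)))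
  have hUpos : ∀ n i, 1 ≤ n → 0 < U n i := fun n i hn => by
    have hn0 : (0:ℝ) < n := by exact_mod_cast hn
    simp only [U]; positivity
  let K : ℕ → ℕ → ℝ := fun n m => ((n:ℝ) ^ (-β₁) * (m:ℝ) ^ (-β₂)) ^ α
  have hK : ∀ n m, 1 ≤ n → 1 ≤ m → 0 < K n m := fun n m hn hm => by
    have hn0 : (0:ℝ) < n := by exact_mod_cast hn
    have hm0 : (0:ℝ) < m := by exact_mod_cast hm
    simp only [K]; positivity
  have hVH : ∀ n m i j, 1 ≤ n → 1 ≤ m → V α (c (i + n) j) (c i (j + m)) = K n m * H n m i j := by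
    intro n m i j hn hm
    have hn0 : (0:ℝ) < n := by exact_mod_cast hn
    have hm0 : (0:ℝ) < m := by exact_mod_cast hm
    have hu := hUpos n i hn
    have hv := hUpos m j hm
    simp only [H, K]
    rw [← V_scale α _ _ _ (by positivity) (mul_ne_zero (hw _ _) (by positivity))]
    have e1 : (1 + ((i + n : ℕ):ℝ)) = n * (1 + U n i) := by simp only [U]; push_cast; field_simp; ring
    have e2 : (1 + ((j + m : ℕ):ℝ)) = m * (1 + U m j) := by simp only [U]; push_cast; field_simp; ring
    have e3 : (1 + (i:ℝ)) = n * U n i := by simp only [U]; field_simp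
    have e4 : (1 + (j:ℝ)) = m * U m j := by simp only [U]; field_simp
    rw [hc, hc, e1, e2, e3, e4, Real.mul_rpow hn0.le (by positivity), Real.mul_rpow hm0.le (by positivity),
      Real.mul_rpow hn0.le (by positivity), Real.mul_rpow hm0.le (by positivity)]
    congr 1 <;> ring
  have hHs : ∀ n m, 1 ≤ n → 1 ≤ m → Summable (fun q : ℕ × ℕ => H n m q.1 q.2) := by
    intro n m hn hm
    have := (hsum n m hn hm).mul_left (K n m)⁻¹
    refine this.congr fun q => ?_
    rw [hVH n m _ _ hn hm, inv_mul_cancel_left₀ (hK n m hn hm).ne']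
  have hval : ∀ n m, 1 ≤ n → 1 ≤ m → ρ n m / ((n : ℝ) ^ (1 - β₁ * α) * (m : ℝ) ^ (1 - β₂ * α)) =
      ∫ s in Ioi (0:ℝ), ∫ t in Ioi (0:ℝ), H n m ⌊(n:ℝ) * s⌋₊ ⌊(m:ℝ) * t⌋₊ := by
    intro n m hn hm
    have hn0 : (0:ℝ) < n := by exact_mod_cast hn
    have hm0 : (0:ℝ) < m := by exact_mod_cast hm
    have hs := hHs n m hn hm
    have i1 : ∀ i, ∫ t in Ioi (0:ℝ), H n m i ⌊(m:ℝ) * t⌋₊ = (1 / m) * ∑' j, H n m i j := fun i =>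
      int_floor m hm (fun j => H n m i j) (hs.prod_factor i)
    simp only [i1]
    rw [integral_const_mul, int_floor n hn (fun i => ∑' j, H n m i j) hs.prod, hρ n m hn hm]
    simp only [hVH n m _ _ hn hm, tsum_mul_left]
    have eK : K n m = (n:ℝ) ^ (-(β₁ * α)) * (m:ℝ) ^ (-(β₂ * α)) := by
      simp only [K]
      rw [Real.mul_rpow (by positivity) (by positivity), ← Real.rpow_mul hn0.le, ← Real.rpow_mul hm0.le,
        neg_mul, neg_mul]
    rw [eK, sub_eq_add_neg, sub_eq_add_neg, Real.rpow_add hn0, Real.rpow_add hm0, Real.rpow_one, Real.rpow_one]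
    have := Real.rpow_pos_of_pos hn0 (-(β₁ * α))
    have := Real.rpow_pos_of_pos hm0 (-(β₂ * α))
    field_simp
  let μ : Measure ℝ := volume.restrict (Ioi 0)
  let G : ℝ × ℝ → ℝ := fun z => ((1 + z.1) ^ (-(β₁ * θ)) * z.1 ^ (-(β₁ * (α - θ)))) *
      ((1 + z.2) ^ (-(β₂ * (α - θ))) * z.2 ^ (-(β₂ * θ)))
  have hG : Integrable G (μ.prod μ) := by
    refine Integrable.mul_prod (f := fun s : ℝ => (1 + s) ^ (-(β₁ * θ)) * s ^ (-(β₁ * (α - θ))))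
      (g := fun t : ℝ => (1 + t) ^ (-(β₂ * (α - θ))) * t ^ (-(β₂ * θ))) ?_ ?_
    · exact g_int _ _ (by positivity) t4 (by nlinarith)
    · exact g_int _ _ (by positivity) t5 (by nlinarith)
  have hae : ∀ᵐ z ∂(μ.prod μ), 0 < z.1 ∧ 0 < z.2 := by
    have : μ.prod μ = (volume.prod volume).restrict (Ioi (0:ℝ) ×ˢ Ioi (0:ℝ)) := by
      simp only [μ]; rw [Measure.prod_restrict]
    rw [this]
    filter_upwards [ae_restrict_mem (measurableSet_Ioi.prod measurableSet_Ioi)] with z hz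
    exact hz
  have hUs : ∀ n : ℕ, 1 ≤ n → ∀ s : ℝ, s ≤ U n ⌊(n:ℝ) * s⌋₊ := by
    intro n hn s
    have hn0 : (0:ℝ) < n := by exact_mod_cast hn
    simp only [U]
    rw [le_div_iff₀ hn0]
    linarith [Nat.lt_floor_add_one ((n:ℝ) * s)]
  have hbound : ∀ n m, 1 ≤ n → 1 ≤ m → ∀ z : ℝ × ℝ, 0 < z.1 → 0 < z.2 →
      ‖H n m ⌊(n:ℝ) * z.1⌋₊ ⌊(m:ℝ) * z.2⌋₊‖ ≤ (b ^ θ * b ^ (α - θ)) * G z := by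
    intro n m hn hm z h1 h2
    have hu := hUpos n ⌊(n:ℝ) * z.1⌋₊ hn
    have hv := hUpos m ⌊(m:ℝ) * z.2⌋₊ hm
    have hp := prod_bound α β₁ β₂ θ z.1 z.2 _ _ b1 b2 t0 t3 h1 h2 (hUs n hn z.1) (hUs m hm z.2)
    simp only [H, Real.norm_eq_abs]
    generalize U n ⌊(n:ℝ) * z.1⌋₊ = u at *
    generalize U m ⌊(m:ℝ) * z.2⌋₊ = v at *
    have hx : 0 < (1 + u) ^ (-β₁) * v ^ (-β₂) := by positivity
    have hy : 0 < u ^ (-β₁) * (1 + v) ^ (-β₂) := by positivity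
    generalize (1 + u) ^ (-β₁) * v ^ (-β₂) = x at *
    generalize u ^ (-β₁) * (1 + v) ^ (-β₂) = y at *
    refine (V_bound α θ _ _ (mul_ne_zero (hw _ _) hx.ne') (mul_ne_zero (hw _ _) hy.ne') t2 t1).trans ?_
    rw [abs_mul, abs_mul, abs_of_pos hx, abs_of_pos hy, Real.mul_rpow (abs_nonneg _) hx.le,
      Real.mul_rpow (abs_nonneg _) hy.le, mul_mul_mul_comm]
    refine mul_le_mul ?_ hp (by positivity) (by positivity)
    exact mul_le_mul (Real.rpow_le_rpow (abs_nonneg _) (hb _ _) t0)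
      (Real.rpow_le_rpow (abs_nonneg _) (hb _ _) hαθ) (by positivity) (by positivity)
  have hfm : ∀ n : ℕ, Measurable (fun s : ℝ => ⌊(n:ℝ) * s⌋₊) := fun n =>
    Nat.measurable_floor.comp (by fun_prop)
  have hmeas : ∀ n m : ℕ, Measurable (fun z : ℝ × ℝ => H n m ⌊(n:ℝ) * z.1⌋₊ ⌊(m:ℝ) * z.2⌋₊) := by
    intro n m
    have h1 : Measurable (fun z : ℝ × ℝ => (⌊(n:ℝ) * z.1⌋₊, ⌊(m:ℝ) * z.2⌋₊)) :=
      ((hfm n).comp measurable_fst).prodMk ((hfm m).comp measurable_snd)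
    have h2 : Measurable (fun q : ℕ × ℕ => H n m q.1 q.2) := measurable_of_countable _
    exact h2.comp h1
  let F : ℝ × ℝ → ℝ := fun z =>
    V α ((1 + z.1) ^ (-β₁) * z.2 ^ (-β₂)) (z.1 ^ (-β₁) * (1 + z.2) ^ (-β₂))
  have hFm : Measurable F := by
    have h1 : Measurable (fun z : ℝ × ℝ =>
      ((1 + z.1) ^ (-β₁) * z.2 ^ (-β₂), z.1 ^ (-β₁) * (1 + z.2) ^ (-β₂))) := by fun_prop
    exact (V_meas α).comp h1
  have hFint : Integrable F (μ.prod μ) := by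
    refine hG.mono' hFm.aestronglyMeasurable ?_
    filter_upwards [hae] with z hz
    obtain ⟨h1, h2⟩ := hz
    have hp := prod_bound α β₁ β₂ θ z.1 z.2 _ _ b1 b2 t0 t3 h1 h2 le_rfl le_rfl
    have hx : 0 < (1 + z.1) ^ (-β₁) * z.2 ^ (-β₂) := by positivity
    have hy : 0 < z.1 ^ (-β₁) * (1 + z.2) ^ (-β₂) := by positivity
    have := V_bound α θ _ _ hx.ne' hy.ne' t2 t1
    rw [abs_of_pos hx, abs_of_pos hy] at this
    exact this.trans hp
  have hev : ∀ᶠ p : ℕ × ℕ in atTop ×ˢ atTop, 1 ≤ p.1 ∧ 1 ≤ p.2 :=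
    (eventually_ge_atTop 1).prod_mk (eventually_ge_atTop 1)
  have hUlim : ∀ s : ℝ, 0 < s → Tendsto (fun n : ℕ => U n ⌊(n:ℝ) * s⌋₊) atTop (nhds s) := by
    intro s hs
    have h1 := (tendsto_nat_floor_mul_div_atTop (R := ℝ) hs.le).comp tendsto_natCast_atTop_atTop
    have h2 := (tendsto_one_div_atTop_nhds_zero_nat (𝕜 := ℝ)).add h1
    rw [zero_add] at h2
    refine h2.congr fun n => ?_
    simp only [U, Function.comp]
    rw [mul_comm s]; ring
  have hfl : ∀ s : ℝ, 0 < s → Tendsto (fun n : ℕ => ⌊(n:ℝ) * s⌋₊) atTop atTop := by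
    intro s hs
    exact tendsto_nat_floor_atTop.comp (tendsto_natCast_atTop_atTop.atTop_mul_const hs)
  have hlim : Tendsto (fun p : ℕ × ℕ => ∫ z, H p.1 p.2 ⌊(p.1:ℝ) * z.1⌋₊ ⌊(p.2:ℝ) * z.2⌋₊ ∂(μ.prod μ))
      (atTop ×ˢ atTop) (nhds (∫ z, F z ∂(μ.prod μ))) := by
    refine tendsto_integral_filter_of_dominated_convergence
      (fun z => (b ^ θ * b ^ (α - θ)) * G z) ?_ ?_ (hG.const_mul _) ?_
    · exact Eventually.of_forall fun p => (hmeas p.1 p.2).aestronglyMeasurable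
    · filter_upwards [hev] with p hp
      filter_upwards [hae] with z hz
      exact hbound _ _ hp.1 hp.2 z hz.1 hz.2
    · filter_upwards [hae] with z hz
      obtain ⟨h1, h2⟩ := hz
      have u1 : Tendsto (fun p : ℕ × ℕ => U p.1 ⌊(p.1:ℝ) * z.1⌋₊) (atTop ×ˢ atTop) (nhds z.1) :=
        (hUlim _ h1).comp tendsto_fst
      have u2 : Tendsto (fun p : ℕ × ℕ => U p.2 ⌊(p.2:ℝ) * z.2⌋₊) (atTop ×ˢ atTop) (nhds z.2) :=
        (hUlim _ h2).comp tendsto_snd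
      have f1 : Tendsto (fun p : ℕ × ℕ => ⌊(p.1:ℝ) * z.1⌋₊) (atTop ×ˢ atTop) atTop :=
        (hfl _ h1).comp tendsto_fst
      have f2 : Tendsto (fun p : ℕ × ℕ => ⌊(p.2:ℝ) * z.2⌋₊) (atTop ×ˢ atTop) atTop :=
        (hfl _ h2).comp tendsto_snd
      have w1 : Tendsto (fun p : ℕ × ℕ => w (⌊(p.1:ℝ) * z.1⌋₊ + p.1) ⌊(p.2:ℝ) * z.2⌋₊)
          (atTop ×ˢ atTop) (nhds 1) :=
        hA1.comp ((tendsto_atTop_mono (fun p => Nat.le_add_right _ _) f1).prodMk f2)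
      have w2 : Tendsto (fun p : ℕ × ℕ => w ⌊(p.1:ℝ) * z.1⌋₊ (⌊(p.2:ℝ) * z.2⌋₊ + p.2))
          (atTop ×ˢ atTop) (nhds 1) :=
        hA1.comp (f1.prodMk (tendsto_atTop_mono (fun p => Nat.le_add_right _ _) f2))
      have hx : 0 < (1 + z.1) ^ (-β₁) * z.2 ^ (-β₂) := by positivity
      refine V_tendsto α _ _ hx.ne' ?_ ?_
      · have := w1.mul (((u1.const_add 1).rpow_const (p := -β₁) (Or.inl (by positivity))).mul
          (u2.rpow_const (p := -β₂) (Or.inl h2.ne')))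
        rwa [one_mul] at this
      · have := w2.mul ((u1.rpow_const (p := -β₁) (Or.inl h1.ne')).mul
          ((u2.const_add 1).rpow_const (p := -β₂) (Or.inl (by positivity))))
        rwa [one_mul] at this
  rw [integral_prod _ hFint] at hlim
  refine hlim.congr' ?_
  filter_upwards [hev] with p hp
  rw [hval _ _ hp.1 hp.2, integral_prod]
  refine (hG.const_mul (b ^ θ * b ^ (α - θ))).mono' (hmeas p.1 p.2).aestronglyMeasurable ?_
  filter_upwards [hae] with z hz
  exact hbound _ _ hp.1 hp.2 z hz.1 hz.2
end

section
/- Let 1 < α ≤ 2, β₁ > 1/(α−1) and β₂ > 1/(α−1), and let (m_n) be a sequence of positive integers with m_n → ∞ and m_n^{−β₂}/n^{−β₁} → ∞ as n → ∞. Then lim_{n→∞} ρ(n,−m_n)/(n^{−β₁} m_n^{−β₂(α−1)}) = Σ_{i=0}^∞ Σ_{j=0}^∞ w_{(∞,j)} w_{(i,∞)}^{α−1} (1+j)^{−β₂} (1+i)^{−β₁(α−1)}. -/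
open Filter MeasureTheory Real Set

lemma aux_bdd (w : ℕ → ℕ → ℝ)
    (hA1 : Tendsto (fun p : ℕ × ℕ => w p.1 p.2) (atTop ×ˢ atTop) (nhds 1))
    (winf : ℕ → ℝ)
    (hA2 : ∀ i, Tendsto (fun j => w i j) atTop (nhds (winf i)))
    (wco : ℕ → ℝ)
    (hA3 : ∀ j, Tendsto (fun i => w i j) atTop (nhds (wco j))) :
    ∃ M : ℝ, 0 < M ∧ ∀ i j, |w i j| ≤ M := by
  have h1 : ∀ i, ∃ B : ℝ, ∀ j, |w i j| ≤ B := by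
    intro i
    obtain ⟨B, hB⟩ := ((hA2 i).abs).bddAbove_range
    exact ⟨B, fun j => hB ⟨j, rfl⟩⟩
  have h2 : ∀ j, ∃ B : ℝ, ∀ i, |w i j| ≤ B := by
    intro j
    obtain ⟨B, hB⟩ := ((hA3 j).abs).bddAbove_range
    exact ⟨B, fun i => hB ⟨i, rfl⟩⟩
  choose B1 hB1 using h1
  choose B2 hB2 using h2
  have h3 : ∀ᶠ p : ℕ × ℕ in atTop, |w p.1 p.2| < 2 := by
    have := hA1.abs
    rw [prod_atTop_atTop_eq] at this
    exact this.eventually_lt_const (by norm_num)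
  obtain ⟨⟨N1, N2⟩, hN⟩ := eventually_atTop.1 h3
  refine ⟨2 + ∑ i ∈ Finset.range N1, |B1 i| + ∑ j ∈ Finset.range N2, |B2 j|, by positivity, ?_⟩
  intro i j
  have e1 : 0 ≤ ∑ i ∈ Finset.range N1, |B1 i| := by positivity
  have e2 : 0 ≤ ∑ j ∈ Finset.range N2, |B2 j| := by positivity
  by_cases hi : i < N1
  · have := Finset.single_le_sum (f := fun i => |B1 i|) (fun i _ => abs_nonneg _)
      (Finset.mem_range.2 hi)
    have h4 := hB1 i j
    have h5 := le_abs_self (B1 i)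
    linarith
  by_cases hj : j < N2
  · have := Finset.single_le_sum (f := fun i => |B2 i|) (fun i _ => abs_nonneg _)
      (Finset.mem_range.2 hj)
    have h4 := hB2 j i
    have h5 := le_abs_self (B2 j)
    linarith
  have := hN (i, j) ⟨by simpa using hi, by simpa using hj⟩
  simp only at this
  linarith

lemma aux_V_bound (α x y : ℝ) (hα2 : α ≤ 2) (hy : y ≠ 0) :
    |V α x y| ≤ |x| * |y| ^ (α - 1) := by
  have hy' : 0 < |y| := abs_pos.2 hy
  unfold V
  rw [if_neg (fun h => hy h.2), abs_div, abs_mul,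
    abs_of_nonneg (by positivity : 0 ≤ (x ^ 2 + y ^ 2) ^ ((2 - α) / 2))]
  rw [div_le_iff₀ (by positivity)]
  have h1 : |y| ^ (2 - α) ≤ (x ^ 2 + y ^ 2) ^ ((2 - α) / 2) := by
    have : |y| ^ (2 - α) = (y ^ 2) ^ ((2 - α) / 2) := by
      rw [← sq_abs y, ← Real.rpow_natCast, ← Real.rpow_mul hy'.le]
      congr 1
      push_cast
      ring
    rw [this]
    apply Real.rpow_le_rpow (by positivity) (by nlinarith [sq_nonneg x]) (by linarith)
  calc |x| * |y| = |x| * |y| ^ (α - 1) * |y| ^ (2 - α) := by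
        rw [mul_assoc, ← Real.rpow_add hy']
        ring_nf
        rw [Real.rpow_one]
    _ ≤ _ := by gcongr

lemma aux_V_scale (α a b X Y : ℝ) (ha : 0 < a) (hb : 0 < b) (hY : Y ≠ 0) :
    V α (a * X) (b * Y) / (a * b ^ (α - 1)) =
      X * Y / ((a / b * X) ^ 2 + Y ^ 2) ^ ((2 - α) / 2) := by
  have hY2 : 0 < Y ^ 2 := by positivity
  unfold V
  rw [if_neg (fun h => (mul_ne_zero hb.ne' hY) h.2)]
  have h1 : (a * X) ^ 2 + (b * Y) ^ 2 = b ^ 2 * ((a / b * X) ^ 2 + Y ^ 2) := by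
    field_simp
  rw [h1, Real.mul_rpow (by positivity) (by positivity)]
  have h2 : (b ^ 2) ^ ((2 - α) / 2) = b ^ (2 - α) := by
    rw [← Real.rpow_natCast, ← Real.rpow_mul hb.le]
    congr 1
    push_cast
    ring
  have h3 : b = b ^ (2 - α) * b ^ (α - 1) := by
    rw [← Real.rpow_add hb]
    ring_nf
    rw [Real.rpow_one]
  rw [h2]
  have hp : 0 < b ^ (2 - α) := by positivity
  have hq : 0 < b ^ (α - 1) := by positivity
  have hD : 0 < ((a / b * X) ^ 2 + Y ^ 2) ^ ((2 - α) / 2) := by positivity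
  generalize ((a / b * X) ^ 2 + Y ^ 2) ^ ((2 - α) / 2) = D at *
  rw [div_div, div_eq_div_iff (by positivity) (by positivity)]
  calc a * X * (b * Y) * D = a * X * ((b ^ (2 - α) * b ^ (α - 1)) * Y) * D := by rw [← h3]
    _ = _ := by ring

lemma aux_ratio (k β : ℝ) (hk : 0 ≤ k) : Tendsto (fun n : ℕ => (1 + (k + (n : ℝ))) ^ (-β) / (n : ℝ) ^ (-β))
    atTop (nhds 1) := by
  have h1 : Tendsto (fun n : ℕ => 1 + (1 + k) / (n : ℝ)) atTop (nhds 1) := by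
    simpa using (tendsto_const_div_atTop_nhds_zero_nat (1 + k)).const_add 1
  have h2 := h1.rpow_const (p := -β) (Or.inl one_ne_zero)
  rw [Real.one_rpow] at h2
  refine h2.congr' ?_
  filter_upwards [eventually_gt_atTop 0] with n hn
  have hn' : (0 : ℝ) < n := by exact_mod_cast hn
  rw [← Real.div_rpow (by positivity) hn'.le]
  congr 1
  field_simp
  ring

theorem stmt11 (α β₁ β₂ : ℝ)
    (hα : 1 < α) (hα2 : α ≤ 2)
    (hβ₁ : 1 / (α - 1) < β₁) (hβ₂ : 1 / (α - 1) < β₂)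
    (w : ℕ → ℕ → ℝ) (hw : ∀ i j, w i j ≠ 0)
    (hA1 : Tendsto (fun p : ℕ × ℕ => w p.1 p.2) (atTop ×ˢ atTop) (nhds 1))
    (winf : ℕ → ℝ)
    (hA2 : ∀ i, Tendsto (fun j => w i j) atTop (nhds (winf i)) ∧ 0 < winf i)
    (wco : ℕ → ℝ)
    (hA3 : ∀ j, Tendsto (fun i => w i j) atTop (nhds (wco j)) ∧ 0 < wco j)
    (c : ℕ → ℕ → ℝ)
    (hc : ∀ i j, c i j = w i j * (1 + (i : ℝ)) ^ (-β₁) * (1 + (j : ℝ)) ^ (-β₂))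
    (ρ : ℕ → ℕ → ℝ)
    (hsum : ∀ n m : ℕ, 1 ≤ n → 1 ≤ m →
      Summable (fun q : ℕ × ℕ => V α (c (q.1 + n) q.2) (c q.1 (q.2 + m))))
    (hρ : ∀ n m : ℕ, 1 ≤ n → 1 ≤ m →
      ρ n m = ∑' i : ℕ, ∑' j : ℕ, V α (c (i + n) j) (c i (j + m)))
    (m : ℕ → ℕ) (hm : ∀ n, 1 ≤ m n)
    (hminf : Tendsto (fun n => m n) atTop atTop)
    (hratio : Tendsto (fun n : ℕ => (m n : ℝ) ^ (-β₂) / (n : ℝ) ^ (-β₁))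
      atTop atTop)
    :
    Tendsto (fun n : ℕ => ρ n (m n) / ((n : ℝ) ^ (-β₁) * (m n : ℝ) ^ (-(β₂ * (α - 1)))))
      atTop
      (nhds (∑' i : ℕ, ∑' j : ℕ,
        wco j * winf i ^ (α - 1) *
          (1 + (j : ℝ)) ^ (-β₂) * (1 + (i : ℝ)) ^ (-(β₁ * (α - 1))))) := by
  have hα1 : 0 < α - 1 := by linarith
  have hb1 : 1 < β₁ * (α - 1) := by rwa [div_lt_iff₀ hα1] at hβ₁
  have hb2 : 1 < β₂ := by
    refine lt_of_le_of_lt ?_ hβ₂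
    rw [le_div_iff₀ hα1]
    linarith
  have hβ₁0 : 0 < β₁ := lt_trans (by positivity) hβ₁
  obtain ⟨M, hM0, hM⟩ := aux_bdd w hA1 winf (fun i => (hA2 i).1) wco (fun j => (hA3 j).1)
  have hsm : ∀ s : ℝ, 1 < s → Summable (fun k : ℕ => (1 + (k : ℝ)) ^ (-s)) := by
    intro s hs
    have := (summable_nat_add_iff 1).2 (Real.summable_nat_rpow.2 (by linarith : -s < -1))
    refine this.congr (fun k => ?_)
    push_cast
    rw [add_comm]
  have hbound : Summable (fun q : ℕ × ℕ => M ^ α * ((1 + (q.1 : ℝ)) ^ (-(β₁ * (α - 1))) *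
      (1 + (q.2 : ℝ)) ^ (-β₂))) :=
    ((hsm _ hb1).mul_of_nonneg (hsm _ hb2) (fun _ => by positivity)
      (fun _ => by positivity)).mul_left _
  have hcne : ∀ i j, c i j ≠ 0 := by
    intro i j
    rw [hc]
    have : 0 < (1 + (i : ℝ)) ^ (-β₁) := by positivity
    have : 0 < (1 + (j : ℝ)) ^ (-β₂) := by positivity
    have := hw i j
    positivity
  have hwinfM : ∀ i, winf i ≤ M := fun i =>
    le_of_tendsto (hA2 i).1 (Eventually.of_forall fun j => (le_abs_self _).trans (hM i j))
  have hwcoM : ∀ j, wco j ≤ M := fun j =>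
    le_of_tendsto (hA3 j).1 (Eventually.of_forall fun i => (le_abs_self _).trans (hM i j))
  have hMpow : M * M ^ (α - 1) = M ^ α := by
    rw [Real.rpow_sub_one hM0.ne']
    field_simp
  -- the limit as a sum over pairs
  have hlimS : Summable (fun q : ℕ × ℕ => wco q.2 * winf q.1 ^ (α - 1) *
          (1 + (q.2 : ℝ)) ^ (-β₂) * (1 + (q.1 : ℝ)) ^ (-(β₁ * (α - 1)))) := by
    refine Summable.of_nonneg_of_le (fun q => ?_) (fun q => ?_) hbound
    · have := (hA2 q.1).2
      have := (hA3 q.2).2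
      positivity
    · have h1 := (hA2 q.1).2
      have h2 := (hA3 q.2).2
      have h3 : winf q.1 ^ (α - 1) ≤ M ^ (α - 1) :=
        Real.rpow_le_rpow h1.le (hwinfM _) hα1.le
      calc _ = (wco q.2 * winf q.1 ^ (α - 1)) * ((1 + (q.1 : ℝ)) ^ (-(β₁ * (α - 1))) *
            (1 + (q.2 : ℝ)) ^ (-β₂)) := by ring
        _ ≤ (M * M ^ (α - 1)) * ((1 + (q.1 : ℝ)) ^ (-(β₁ * (α - 1))) *
            (1 + (q.2 : ℝ)) ^ (-β₂)) := by
            gcongr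
            exact hwcoM _
        _ = _ := by rw [hMpow]
  rw [← hlimS.tsum_prod (f := fun q : ℕ × ℕ => wco q.2 * winf q.1 ^ (α - 1) *
          (1 + (q.2 : ℝ)) ^ (-β₂) * (1 + (q.1 : ℝ)) ^ (-(β₁ * (α - 1))))]
  have hrpw : ∀ n : ℕ, (m n : ℝ) ^ (-(β₂ * (α - 1))) = ((m n : ℝ) ^ (-β₂)) ^ (α - 1) := by
    intro n
    rw [← Real.rpow_mul (by positivity)]
    congr 1
    ring
  have hmpos : ∀ n, (0 : ℝ) < m n := fun n => by exact_mod_cast hm n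
  have hmain : Tendsto (fun n : ℕ => ∑' q : ℕ × ℕ, V α (c (q.1 + n) q.2) (c q.1 (q.2 + m n)) /
      ((n : ℝ) ^ (-β₁) * (m n : ℝ) ^ (-(β₂ * (α - 1))))) atTop
      (nhds (∑' q : ℕ × ℕ, wco q.2 * winf q.1 ^ (α - 1) *
          (1 + (q.2 : ℝ)) ^ (-β₂) * (1 + (q.1 : ℝ)) ^ (-(β₁ * (α - 1))))) := by
    refine tendsto_tsum_of_dominated_convergence hbound ?_ ?_
    · rintro ⟨i, j⟩
      simp only
      set X : ℕ → ℝ := fun n => c (i + n) j / (n : ℝ) ^ (-β₁) with hX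
      set Y : ℕ → ℝ := fun n => c i (j + m n) / (m n : ℝ) ^ (-β₂) with hY
      have hXl : Tendsto X atTop (nhds (wco j * (1 + (j : ℝ)) ^ (-β₂))) := by
        have h1 : Tendsto (fun n => w (i + n) j) atTop (nhds (wco j)) :=
          (hA3 j).1.comp (tendsto_atTop_mono (fun n => Nat.le_add_left n i) tendsto_id)
        have h2 := ((h1.mul (aux_ratio i β₁ (by positivity))).mul_const ((1 + (j : ℝ)) ^ (-β₂)))
        rw [mul_one] at h2
        refine h2.congr (fun n => ?_)
        simp only [hX, hc]
        push_cast
        ring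
      have hYl : Tendsto Y atTop (nhds (winf i * (1 + (i : ℝ)) ^ (-β₁))) := by
        have h1 : Tendsto (fun n => w i (j + n)) atTop (nhds (winf i)) :=
          (hA2 i).1.comp (tendsto_atTop_mono (fun n => Nat.le_add_left n j) tendsto_id)
        have h2 := ((h1.mul (aux_ratio j β₂ (by positivity))).mul_const ((1 + (i : ℝ)) ^ (-β₁)))
        rw [mul_one] at h2
        refine (h2.comp hminf).congr (fun n => ?_)
        simp only [hY, hc, Function.comp]
        push_cast
        ring
      have hrl : Tendsto (fun n : ℕ => (n : ℝ) ^ (-β₁) / (m n : ℝ) ^ (-β₂)) atTop (nhds 0) := by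
        refine hratio.inv_tendsto_atTop.congr (fun n => ?_)
        simp
      have hYpos : 0 < winf i * (1 + (i : ℝ)) ^ (-β₁) := by
        have := (hA2 i).2
        positivity
      have hden := (((hrl.mul hXl).pow 2).add (hYl.pow 2)).rpow_const
        (p := (2 - α) / 2) (Or.inl (by simp only [zero_mul]; positivity))
      have hfin := (hXl.mul hYl).div hden (by
        simp only [zero_mul]
        positivity)
      have hlim : wco j * (1 + (j : ℝ)) ^ (-β₂) * (winf i * (1 + (i : ℝ)) ^ (-β₁)) /
          ((0 * (wco j * (1 + (j : ℝ)) ^ (-β₂))) ^ 2 +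
            (winf i * (1 + (i : ℝ)) ^ (-β₁)) ^ 2) ^ ((2 - α) / 2) =
          wco j * winf i ^ (α - 1) *
          (1 + (j : ℝ)) ^ (-β₂) * (1 + (i : ℝ)) ^ (-(β₁ * (α - 1))) := by
        have e1 : (1 + (i : ℝ)) ^ (-(β₁ * (α - 1))) = ((1 + (i : ℝ)) ^ (-β₁)) ^ (α - 1) := by
          rw [← Real.rpow_mul (by positivity)]
          congr 1
          ring
        have e2 : winf i ^ (α - 1) * ((1 + (i : ℝ)) ^ (-β₁)) ^ (α - 1) =
            (winf i * (1 + (i : ℝ)) ^ (-β₁)) ^ (α - 1) :=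
          (Real.mul_rpow (hA2 i).2.le (by positivity)).symm
        rw [e1]
        calc _ = wco j * (1 + (j : ℝ)) ^ (-β₂) * (winf i * (1 + (i : ℝ)) ^ (-β₁)) ^ (α - 1) := by
              generalize winf i * (1 + (i : ℝ)) ^ (-β₁) = y at hYpos ⊢
              have e3 : (y ^ 2) ^ ((2 - α) / 2) = y ^ (2 - α) := by
                rw [← Real.rpow_natCast, ← Real.rpow_mul hYpos.le]
                congr 1
                push_cast
                ring
              rw [zero_mul, zero_pow two_ne_zero, zero_add, e3, div_eq_iff (by positivity),
                mul_assoc _ (y ^ (α - 1)), ← Real.rpow_add hYpos]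
              ring_nf
              rw [Real.rpow_one]
          _ = _ := by rw [← e2]; ring
      rw [hlim] at hfin
      refine hfin.congr' ?_
      filter_upwards [eventually_gt_atTop 0] with n hn
      have hn' : (0 : ℝ) < n := by exact_mod_cast hn
      have ha : 0 < (n : ℝ) ^ (-β₁) := by positivity
      have hb : 0 < (m n : ℝ) ^ (-β₂) := Real.rpow_pos_of_pos (hmpos n) _
      have hYn : Y n ≠ 0 := div_ne_zero (hcne _ _) hb.ne'
      have := aux_V_scale α _ _ (X n) (Y n) ha hb hYn
      rw [hrpw n]
      have k1 : (n : ℝ) ^ (-β₁) * X n = c (i + n) j := mul_div_cancel₀ _ ha.ne'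
      have k2 : (m n : ℝ) ^ (-β₂) * Y n = c i (j + m n) := mul_div_cancel₀ _ hb.ne'
      rw [k1, k2] at this
      rw [this]
      rfl
    · filter_upwards [eventually_gt_atTop 0] with n hn
      rintro ⟨i, j⟩
      simp only
      have hn' : (0 : ℝ) < n := by exact_mod_cast hn
      have hmn := hmpos n
      have ha : 0 < (n : ℝ) ^ (-β₁) := by positivity
      have hb : 0 < (m n : ℝ) ^ (-β₂) := by positivity
      rw [hrpw n, Real.norm_eq_abs, abs_div,
        abs_of_pos (by positivity : 0 < (n : ℝ) ^ (-β₁) * ((m n : ℝ) ^ (-β₂)) ^ (α - 1)),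
        div_le_iff₀ (by positivity)]
      refine (aux_V_bound α _ _ hα2 (hcne _ _)).trans ?_
      have hx : |c (i + n) j| ≤ M * (n : ℝ) ^ (-β₁) * (1 + (j : ℝ)) ^ (-β₂) := by
        rw [hc, abs_mul, abs_mul, abs_of_nonneg (by positivity : 0 ≤ (1 + (j : ℝ)) ^ (-β₂)),
          abs_of_nonneg (by positivity : 0 ≤ (1 + ((i + n : ℕ) : ℝ)) ^ (-β₁))]
        have : (1 + ((i + n : ℕ) : ℝ)) ^ (-β₁) ≤ (n : ℝ) ^ (-β₁) := by
          apply Real.rpow_le_rpow_of_nonpos hn' _ (by linarith)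
          push_cast
          linarith [(Nat.cast_nonneg i : (0 : ℝ) ≤ i)]
        gcongr
        exact hM _ _
      have hy : |c i (j + m n)| ≤ M * (1 + (i : ℝ)) ^ (-β₁) * (m n : ℝ) ^ (-β₂) := by
        rw [hc, abs_mul, abs_mul, abs_of_nonneg (by positivity : 0 ≤ (1 + (i : ℝ)) ^ (-β₁)),
          abs_of_nonneg (by positivity : 0 ≤ (1 + ((j + m n : ℕ) : ℝ)) ^ (-β₂))]
        have : (1 + ((j + m n : ℕ) : ℝ)) ^ (-β₂) ≤ (m n : ℝ) ^ (-β₂) := by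
          apply Real.rpow_le_rpow_of_nonpos hmn _ (by linarith)
          push_cast
          linarith [(Nat.cast_nonneg j : (0 : ℝ) ≤ j)]
        gcongr
        exact hM _ _
      have e1 : (1 + (i : ℝ)) ^ (-(β₁ * (α - 1))) = ((1 + (i : ℝ)) ^ (-β₁)) ^ (α - 1) := by
        rw [← Real.rpow_mul (by positivity)]
        congr 1
        ring
      calc _ ≤ (M * (n : ℝ) ^ (-β₁) * (1 + (j : ℝ)) ^ (-β₂)) *
            (M * (1 + (i : ℝ)) ^ (-β₁) * (m n : ℝ) ^ (-β₂)) ^ (α - 1) := by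
            apply mul_le_mul hx _ (by positivity) (by positivity)
            exact Real.rpow_le_rpow (abs_nonneg _) hy hα1.le
        _ = _ := by
            rw [Real.mul_rpow (by positivity) (by positivity),
              Real.mul_rpow (by positivity) (by positivity), e1, ← hMpow]
            ring
  refine hmain.congr' ?_
  filter_upwards [eventually_ge_atTop 1] with n hn
  rw [tsum_div_const, hρ n (m n) hn (hm n), (hsum n (m n) hn (hm n)).tsum_prod]
end
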